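/- Let α ∈ ℝ, α ≠ 0, and set E₁ := −exp(4π/α). For λ ∈ ℂ\{0} define k₀^±(λ) := (λ, ±iλ) ∈ ℂ². Then for either choice of sign and every λ ∈ ℂ\{0}: d(k₀^±(λ)) := 1 − (α/(2π))·ln(|Re k₀^±(λ)| + |Im k₀^±(λ)|) = 0 if and only if |λ| = (1/2)·√(−E₁) = (1/2)·exp(2π/α). Hence at zero energy the Faddeev generalized scattering data a(k₀^±(λ)) = b(k₀^±(λ)) = (2π)⁻²·α/d(k₀^±(λ)) are singular in λ exactly on the circle {λ ∈ ℂ : |λ| = √(−E₁)/2} and are continuous on ℂ\({|λ| = √(−E₁)/2} ∪ {0}), on both components Σ₀^±. -/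

import Mathlib

/-- Euclidean norm `|Re k|` of the componentwise real part of `k ∈ ℂ²`. -/
noncomputable def normRe (k : ℂ × ℂ) : ℝ := Real.sqrt (k.1.re ^ 2 + k.2.re ^ 2)

/-- Euclidean norm `|Im k|` of the componentwise imaginary part of `k ∈ ℂ²`. -/
noncomputable def normIm (k : ℂ × ℂ) : ℝ := Real.sqrt (k.1.im ^ 2 + k.2.im ^ 2)

/-- The parametrization `k₀^±(λ) = (λ, ±iλ)` of the two components of the zero-energy
surface: `σ = 1` gives `k₀⁺`, `σ = −1` gives `k₀⁻`. -/
noncomputable def k0 (σ : ℝ) (lam : ℂ) : ℂ × ℂ := (lam, (σ : ℂ) * Complex.I * lam)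

/-- The denominator `d(k) = 1 − (α/2π)·ln(|Re k| + |Im k|)` of the Faddeev generalized
scattering data `a(k) = b(k) = (2π)⁻²·α/d(k)` of the 2D point potential of strength `α`. -/
noncomputable def dFad (α : ℝ) (k : ℂ × ℂ) : ℝ :=
  1 - α / (2 * Real.pi) * Real.log (normRe k + normIm k)

theorem dFad_k0_aux (α σ : ℝ) (hσ : σ = 1 ∨ σ = -1) (lam : ℂ) :
    dFad α (k0 σ lam) = 1 - α / (2 * Real.pi) * Real.log (2 * ‖lam‖) := by
  have h1 : normRe (k0 σ lam) = ‖lam‖ := by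
    rw [Complex.norm_eq_sqrt_sq_add_sq]
    rcases hσ with rfl | rfl <;> simp [normRe, k0]
  have h2 : normIm (k0 σ lam) = ‖lam‖ := by
    rw [Complex.norm_eq_sqrt_sq_add_sq]
    rcases hσ with rfl | rfl <;> simp [normIm, k0, add_comm]
  rw [dFad, h1, h2, two_mul ‖lam‖]

/-- Let `α ≠ 0`, `E₁ := −exp(4π/α)`. Then for either sign and every `λ ∈ ℂ\{0}`:
`d(k₀^±(λ)) = 0 ↔ |λ| = (1/2)√(−E₁) = (1/2)exp(2π/α)`; hence at zero energy the Faddeev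
generalized scattering data `(2π)⁻²·α/d(k₀^±(λ))` are singular exactly on this circle
and continuous elsewhere on `ℂ\{0}`, on both components `Σ₀^±`. -/
theorem point_potential_data_contour_singularities_zero_energy
    (α : ℝ) (hα : α ≠ 0) (σ : ℝ) (hσ : σ = 1 ∨ σ = -1) :
    (∀ lam : ℂ, lam ≠ 0 →
      (dFad α (k0 σ lam) = 0 ↔
        ‖lam‖ = Real.sqrt (Real.exp (4 * Real.pi / α)) / 2)) ∧
    (Real.sqrt (Real.exp (4 * Real.pi / α)) / 2 = Real.exp (2 * Real.pi / α) / 2) ∧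
    ContinuousOn (fun lam : ℂ => ((2 * Real.pi) ^ 2)⁻¹ * α / dFad α (k0 σ lam))
      {lam : ℂ | lam ≠ 0 ∧ ‖lam‖ ≠ Real.sqrt (Real.exp (4 * Real.pi / α)) / 2} := by
  have hs : Real.sqrt (Real.exp (4 * Real.pi / α)) = Real.exp (2 * Real.pi / α) := by
    rw [← Real.exp_half]
    congr 1
    ring
  have hpi := Real.pi_ne_zero
  have key : ∀ lam : ℂ, lam ≠ 0 →
      (dFad α (k0 σ lam) = 0 ↔
        ‖lam‖ = Real.sqrt (Real.exp (4 * Real.pi / α)) / 2) := by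
    intro lam hl
    have hpos : 0 < 2 * ‖lam‖ := by positivity
    rw [dFad_k0_aux α σ hσ, hs]
    constructor
    · intro h
      have h3 : Real.log (2 * ‖lam‖) = 2 * Real.pi / α := by
        field_simp at h ⊢
        linarith
      rw [← h3, Real.exp_log hpos]
      ring
    · intro h
      rw [h, mul_div_cancel₀ _ (two_ne_zero), Real.log_exp]
      field_simp
      ring
  refine ⟨key, by rw [hs], ?_⟩
  apply ContinuousOn.div continuousOn_const
  · simp only [dFad_k0_aux α σ hσ]
    refine continuousOn_const.sub (continuousOn_const.mul (ContinuousOn.log (by fun_prop) ?_))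
    intro x hx
    have := norm_ne_zero_iff.mpr hx.1
    positivity
  · intro x hx h
    exact hx.2 ((key x hx.1).1 h)
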